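/- arXiv:2005.07015 — 2 statements merged into one kernel-verified Lean document; each statement's English description precedes it below -/
import Mathlib

section
/- Let p, q be positive reals and let g : ℝ → ℝ be a nonnegative measurable function. Then ∫₀^∞ ∫₀^∞ (y^(7/2)/(x^(1/2)·(x+y)^(5/2))) · g(xy/(x+y)) · exp(-p·x - q·y) dx dy = (2·p/q) · ∫₀^∞ g(t) · t^(3/2) · exp(-(p+q)·t) · K₂(2·√p·√q·t) dt. -/
open MeasureTheory Real

/-- Modified Bessel function of the second kind, via its integral representation
`K_ν(z) = ∫₀^∞ exp(-z cosh u) cosh (ν u) du`. -/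
noncomputable def besselK (ν : ℝ) (z : ℝ) : ℝ :=
  ∫ u in Set.Ioi (0:ℝ), Real.exp (-z * Real.cosh u) * Real.cosh (ν * u)

lemma aux_scale (a : ℝ) (ha : 0 < a) (f : ℝ → ENNReal) :
    ∫⁻ y in Set.Ioi (0:ℝ), f y = ∫⁻ s in Set.Ioi (0:ℝ), ENNReal.ofReal a * f (a * s) := by
  have himg : (fun s : ℝ => a * s) '' Set.Ioi 0 = Set.Ioi 0 := by
    ext y
    constructor
    · rintro ⟨s, hs, rfl⟩
      exact mul_pos ha hs
    · intro hy
      exact ⟨y / a, div_pos hy ha, by field_simp⟩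
  have h := lintegral_image_eq_lintegral_abs_deriv_mul (s := Set.Ioi (0:ℝ))
    (f := fun s => a * s) (f' := fun _ => a) measurableSet_Ioi
    (fun x _ => by simpa using ((hasDerivAt_id x).const_mul a).hasDerivWithinAt)
    (fun x _ y _ hxy => mul_left_cancel₀ ha.ne' hxy) f
  rw [himg] at h
  simpa [abs_of_pos ha] using h

lemma aux_exp (c : ℝ) (hc : 0 < c) (f : ℝ → ENNReal) :
    ∫⁻ y in Set.Ioi (0:ℝ), f y = ∫⁻ u, ENNReal.ofReal (c * exp u) * f (c * exp u) := by
  have himg : (fun s : ℝ => c * exp s) '' Set.univ = Set.Ioi 0 := by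
    ext y
    constructor
    · rintro ⟨s, hs, rfl⟩
      exact mul_pos hc (exp_pos s)
    · intro hy
      refine ⟨log (y / c), trivial, ?_⟩
      have : 0 < y / c := div_pos hy hc
      simp only [exp_log this]
      field_simp
  have h := lintegral_image_eq_lintegral_abs_deriv_mul (s := Set.univ)
    (f := fun s => c * exp s) (f' := fun s => c * exp s) MeasurableSet.univ
    (fun x _ => ((Real.hasDerivAt_exp x).const_mul c).hasDerivWithinAt)
    (fun x _ y _ hxy => exp_injective (mul_left_cancel₀ hc.ne' hxy)) f
  rw [himg] at h
  have h2 : ∀ u, |c * exp u| = c * exp u := fun u => abs_of_pos (mul_pos hc (exp_pos u))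
  simpa [h2] using h

lemma aux_neg (f : ℝ → ENNReal) (hf : Measurable f) :
    ∫⁻ u, f u = ∫⁻ u in Set.Ioi (0:ℝ), (f u + f (-u)) := by
  have himg : (fun s : ℝ => -s) '' Set.Ioi 0 = Set.Iio 0 := by
    ext y
    simp
  have h := lintegral_image_eq_lintegral_abs_deriv_mul (s := Set.Ioi (0:ℝ))
    (f := fun s => -s) (f' := fun s => -1) measurableSet_Ioi
    (fun x _ => ((hasDerivAt_id x).neg).hasDerivWithinAt)
    (fun x _ y _ hxy => neg_injective hxy) f
  rw [himg] at h
  rw [lintegral_add_left hf, ← lintegral_add_compl f (measurableSet_Ioi (a := (0:ℝ))),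
    Set.compl_Ioi, setLIntegral_congr Iio_ae_eq_Iic.symm, h]
  simp

lemma aux_int (z : ℝ) (hz : 0 < z) :
    IntegrableOn (fun u => Real.exp (-z * Real.cosh u) * Real.cosh (2 * u)) (Set.Ioi 0) := by
  refine integrable_of_isBigO_exp_neg (b := 1) one_pos (by fun_prop) ?_
  refine Asymptotics.IsBigO.of_bound (48 / z ^ 3) ?_
  filter_upwards [Filter.eventually_ge_atTop 0] with u hu
  have hcp := Real.cosh_pos (2 * u)
  rw [Real.norm_of_nonneg (by positivity), Real.norm_of_nonneg (by positivity)]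
  have h1 : z * exp u / 2 ≤ z * Real.cosh u := by
    rw [Real.cosh_eq]
    have := exp_pos (-u)
    nlinarith [mul_pos hz this]
  have h2 : Real.cosh (2 * u) ≤ exp u ^ 2 := by
    have e : exp (2 * u) = exp u ^ 2 := by rw [← exp_nat_mul]; norm_num
    rw [Real.cosh_eq, ← e]
    have : exp (-(2 * u)) ≤ exp (2 * u) := exp_le_exp.2 (by linarith)
    linarith
  have h3 := Real.pow_div_factorial_le_exp (z * exp u / 2) (by positivity) 3
  have h4 : exp (-z * Real.cosh u) ≤ (exp (z * exp u / 2))⁻¹ := by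
    rw [← exp_neg]
    exact exp_le_exp.2 (by linarith)
  have h5 : (exp (z * exp u / 2))⁻¹ ≤ ((z * exp u / 2) ^ 3 / (Nat.factorial 3 : ℝ))⁻¹ :=
    inv_anti₀ (by positivity) h3
  calc _ ≤ ((z * exp u / 2) ^ 3 / (Nat.factorial 3 : ℝ))⁻¹ * exp u ^ 2 :=
        mul_le_mul (h4.trans h5) h2 hcp.le (by positivity)
    _ = _ := by
      have : exp (-1 * u) = (exp u)⁻¹ := by rw [← exp_neg]; congr 1; ring
      rw [this]
      have := exp_pos u
      norm_num [Nat.factorial]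
      field_simp
      try norm_num

lemma aux_bessel (p q t : ℝ) (hp : 0 < p) (hq : 0 < q) (ht : 0 < t) :
    ∫⁻ s in Set.Ioi (0:ℝ), ENNReal.ofReal (s * exp (-t * (p / s + q * s))) =
      ENNReal.ofReal (2 * p / q) *
        ENNReal.ofReal (besselK 2 (2 * Real.sqrt p * Real.sqrt q * t)) := by
  obtain ⟨a, ha, rfl⟩ : ∃ a : ℝ, 0 < a ∧ a ^ 2 = p := ⟨√p, by positivity, sq_sqrt hp.le⟩
  obtain ⟨b, hb, rfl⟩ : ∃ b : ℝ, 0 < b ∧ b ^ 2 = q := ⟨√q, by positivity, sq_sqrt hq.le⟩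
  rw [sqrt_sq ha.le, sqrt_sq hb.le, besselK,
    ofReal_integral_eq_lintegral_ofReal (aux_int _ (by positivity))
      (Filter.Eventually.of_forall fun u => mul_nonneg (exp_pos _).le (Real.cosh_pos _).le),
    ← lintegral_const_mul _ (by fun_prop), aux_exp (a / b) (by positivity), aux_neg _ (by fun_prop)]
  refine lintegral_congr fun u => ?_
  have hu := exp_pos u
  have key : ∀ v, ENNReal.ofReal (a / b * exp v) *
      ENNReal.ofReal (a / b * exp v * exp (-t * (a ^ 2 / (a / b * exp v) + b ^ 2 * (a / b * exp v))))
      = ENNReal.ofReal (a ^ 2 / b ^ 2 * exp (2 * v) * exp (-(2 * a * b * t) * Real.cosh v)) := by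
    intro v
    have hv := exp_pos v
    have e : exp (2 * v) = exp v ^ 2 := by rw [← exp_nat_mul]; norm_num
    have e2 : -t * (a ^ 2 / (a / b * exp v) + b ^ 2 * (a / b * exp v))
        = -(2 * a * b * t) * Real.cosh v := by
      rw [Real.cosh_eq, exp_neg]
      field_simp
      try ring
    rw [← ENNReal.ofReal_mul (by positivity), e2, e]
    congr 1
    field_simp
  rw [key, key, ← ENNReal.ofReal_add (by positivity) (by positivity),
    ← ENNReal.ofReal_mul (by positivity), Real.cosh_neg]
  congr 1
  rw [Real.cosh_eq (2 * u), show 2 * -u = -(2 * u) by ring]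
  field_simp

lemma aux_pt (p q t s G : ℝ) (ht : 0 < t) (hs : 0 < s) :
    (1 + 1 / s) * ((t * (1 + 1 / s)) * ((((t * (1 + 1 / s)) * s) ^ ((7:ℝ)/2) /
      ((t * (1 + 1 / s)) ^ ((1:ℝ)/2) * ((t * (1 + 1 / s)) + (t * (1 + 1 / s)) * s) ^ ((5:ℝ)/2))) *
      G * exp (-p * (t * (1 + 1 / s)) - q * ((t * (1 + 1 / s)) * s))))
    = (G * t ^ ((3:ℝ)/2) * exp (-(p + q) * t)) * (s * exp (-t * (p / s + q * s))) := by
  have e1 : exp (-p * (t * (1 + 1 / s)) - q * ((t * (1 + 1 / s)) * s))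
      = exp (-(p + q) * t) * exp (-t * (p / s + q * s)) := by
    rw [← exp_add]; congr 1; field_simp; ring
  have hpow : ∀ w : ℝ, 0 < w → w ^ ((7:ℝ)/2) = w ^ 3 * √w ∧ w ^ ((5:ℝ)/2) = w ^ 2 * √w ∧
      w ^ ((3:ℝ)/2) = w * √w := by
    intro w hw
    rw [sqrt_eq_rpow]
    refine ⟨?_, ?_, ?_⟩
    · rw [← rpow_natCast, ← rpow_add hw]; norm_num
    · rw [← rpow_natCast, ← rpow_add hw]; norm_num
    · nth_rewrite 2 [← rpow_one w]
      rw [← rpow_add hw]; norm_num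
  have h1s : 0 < 1 + s := by linarith
  have a1 : t * (1 + 1 / s) * s = t * (1 + s) := by field_simp; try ring
  have a2 : t * (1 + 1 / s) + t * (1 + s) = t * (1 + s) ^ 2 / s := by field_simp; try ring
  have a3 : t * (1 + 1 / s) = t * (1 + s) / s := by field_simp; try ring
  rw [e1, a1, a2, a3, (hpow (t * (1 + s)) (by positivity)).1,
    (hpow (t * (1 + s) ^ 2 / s) (by positivity)).2.1, (hpow t ht).2.2, ← sqrt_eq_rpow]
  rw [sqrt_div (by positivity), sqrt_div (by positivity), sqrt_mul ht.le, sqrt_mul ht.le,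
    sqrt_sq h1s.le]
  have := sq_sqrt ht.le
  have h2 := sq_sqrt hs.le
  have h3 := sq_sqrt h1s.le
  have p1 : 0 < √t := by positivity
  have p2 : 0 < √s := by positivity
  have p3 : 0 < √(1 + s) := by positivity
  generalize √t = T at *
  generalize √(1 + s) = V at *
  generalize √s = S at *
  generalize exp (-(p + q) * t) = E1
  generalize exp (-t * (p / s + q * s)) = E2
  field_simp
  rw [this, h2]
  try ring

theorem stmt_9 (p q : ℝ) (hp : 0 < p) (hq : 0 < q) (g : ℝ → ℝ)
    (hg : Measurable g) (hg0 : ∀ t, 0 ≤ g t) :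
    (∫⁻ x in Set.Ioi (0:ℝ), ∫⁻ y in Set.Ioi (0:ℝ),
        ENNReal.ofReal ((y ^ ((7:ℝ)/2) / (x ^ ((1:ℝ)/2) * (x + y) ^ ((5:ℝ)/2))) *
          g (x * y / (x + y)) * Real.exp (-p * x - q * y)))
    = ENNReal.ofReal (2 * p / q) *
      ∫⁻ t in Set.Ioi (0:ℝ),
        ENNReal.ofReal (g t * t ^ ((3:ℝ)/2) * Real.exp (-(p + q) * t) *
          besselK 2 (2 * Real.sqrt p * Real.sqrt q * t)) := by
  set F : ℝ → ℝ → ENNReal := fun x y =>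
    ENNReal.ofReal ((y ^ ((7:ℝ)/2) / (x ^ ((1:ℝ)/2) * (x + y) ^ ((5:ℝ)/2))) *
          g (x * y / (x + y)) * Real.exp (-p * x - q * y)) with hF
  have hFm : Measurable (Function.uncurry F) := by
    simp only [hF, Function.uncurry_def]
    fun_prop
  have hFm' : ∀ {α : Type} [MeasurableSpace α] (a b : α → ℝ), Measurable a → Measurable b →
      Measurable fun w => F (a w) (b w) := fun a b ha hb => hFm.comp (ha.prodMk hb)
  calc (∫⁻ x in Set.Ioi (0:ℝ), ∫⁻ y in Set.Ioi (0:ℝ), F x y)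
      = ∫⁻ x in Set.Ioi (0:ℝ), ∫⁻ s in Set.Ioi (0:ℝ), ENNReal.ofReal x * F x (x * s) :=
        setLIntegral_congr_fun measurableSet_Ioi fun x hx => aux_scale x hx _
    _ = ∫⁻ s in Set.Ioi (0:ℝ), ∫⁻ x in Set.Ioi (0:ℝ), ENNReal.ofReal x * F x (x * s) := by
        refine lintegral_lintegral_swap (Measurable.aemeasurable ?_)
        simp only [Function.uncurry_def]
        exact Measurable.mul (by fun_prop) (hFm' _ _ (by fun_prop) (by fun_prop))
    _ = ∫⁻ s in Set.Ioi (0:ℝ), ∫⁻ t in Set.Ioi (0:ℝ),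
          ENNReal.ofReal (g t * t ^ ((3:ℝ)/2) * exp (-(p + q) * t)) *
          ENNReal.ofReal (s * exp (-t * (p / s + q * s))) := by
        refine setLIntegral_congr_fun measurableSet_Ioi fun s hs => ?_
        have hs : 0 < s := hs
        have hs' : 0 < 1 + 1 / s := by positivity
        rw [aux_scale (1 + 1 / s) hs']
        refine setLIntegral_congr_fun measurableSet_Ioi fun t ht => ?_
        have ht : 0 < t := ht
        have hgt := hg0 t
        simp only [hF]
        rw [mul_comm (1 + 1 / s) t]
        have hgg : t * (1 + 1 / s) * (t * (1 + 1 / s) * s) /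
            (t * (1 + 1 / s) + t * (1 + 1 / s) * s) = t := by
          have : 1 + s ≠ 0 := by positivity
          have : s + 1 ≠ 0 := by positivity
          field_simp
          try ring
        rw [hgg, ← ENNReal.ofReal_mul (by positivity), ← ENNReal.ofReal_mul (by positivity),
          ← ENNReal.ofReal_mul (by positivity), aux_pt p q t s (g t) ht hs]
    _ = ∫⁻ t in Set.Ioi (0:ℝ), ∫⁻ s in Set.Ioi (0:ℝ),
          ENNReal.ofReal (g t * t ^ ((3:ℝ)/2) * exp (-(p + q) * t)) *
          ENNReal.ofReal (s * exp (-t * (p / s + q * s))) := by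
        refine lintegral_lintegral_swap (Measurable.aemeasurable ?_)
        simp only [Function.uncurry_def]
        fun_prop
    _ = ∫⁻ t in Set.Ioi (0:ℝ), ENNReal.ofReal (2 * p / q) *
          ENNReal.ofReal (g t * t ^ ((3:ℝ)/2) * Real.exp (-(p + q) * t) *
          besselK 2 (2 * Real.sqrt p * Real.sqrt q * t)) := by
        refine setLIntegral_congr_fun measurableSet_Ioi fun t ht => ?_
        have ht : 0 < t := ht
        have hgt := hg0 t
        rw [lintegral_const_mul _ (by fun_prop), aux_bessel p q t hp hq ht,
          ENNReal.ofReal_mul (p := g t * t ^ ((3:ℝ)/2) * Real.exp (-(p + q) * t)) (by positivity)]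
        ring
    _ = _ := lintegral_const_mul' _ _ ENNReal.ofReal_ne_top
end

section
/- Let p, q be positive reals and let f : ℝ → ℝ be a nonnegative measurable function. Then ∫₀^∞ ∫₀^∞ (x^(1/2)/(y^(1/2)·(x+y)^(1/2))) · f(xy/(x+y)) · exp(-p·x - q·y) dx dy = (2/√p) · ∫₀^∞ f(t) · t^(1/2) · exp(-(p+q)·t) · (√p·K₀(2·√p·√q·t) + √q·K₁(2·√p·√q·t)) dt. -/
open MeasureTheory Real

lemma aux_sub_exp (c : ℝ) (hc : 0 < c) (g : ℝ → ENNReal) :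
    ∫⁻ y in Set.Ioi (0:ℝ), g y
      = ∫⁻ u : ℝ, ENNReal.ofReal (c * Real.exp (-u)) * g (c * Real.exp (-u)) := by
  have himg : (fun u : ℝ => c * Real.exp (-u)) '' Set.univ = Set.Ioi 0 := by
    ext y
    simp only [Set.image_univ, Set.mem_range, Set.mem_Ioi]
    constructor
    · rintro ⟨u, rfl⟩
      positivity
    · intro hy
      refine ⟨-Real.log (y / c), ?_⟩
      rw [neg_neg, Real.exp_log (by positivity)]
      field_simp
  have hinj : Set.InjOn (fun u : ℝ => c * Real.exp (-u)) Set.univ := by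
    intro a _ b _ h
    have h1 : Real.exp (-a) = Real.exp (-b) := mul_left_cancel₀ hc.ne' h
    have := Real.exp_injective h1
    linarith
  have hd : ∀ u ∈ (Set.univ : Set ℝ), HasDerivWithinAt (fun u : ℝ => c * Real.exp (-u))
      (-(c * Real.exp (-u))) Set.univ u := by
    intro u _
    have := ((hasDerivAt_neg u).exp.const_mul c).hasDerivWithinAt (s := Set.univ)
    refine this.congr_deriv ?_
    ring
  rw [← himg, lintegral_image_eq_lintegral_abs_deriv_mul MeasurableSet.univ hd hinj]
  simp only [Measure.restrict_univ]
  refine lintegral_congr fun u => ?_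
  rw [abs_neg, abs_of_pos (by positivity)]

lemma aux_sub_scale (a : ℝ) (ha : 0 < a) (g : ℝ → ENNReal) :
    ∫⁻ y in Set.Ioi (0:ℝ), g y
      = ∫⁻ t in Set.Ioi (0:ℝ), ENNReal.ofReal a * g (a * t) := by
  have himg : (fun u : ℝ => a * u) '' Set.Ioi 0 = Set.Ioi 0 := by
    ext y
    simp only [Set.mem_image, Set.mem_Ioi]
    constructor
    · rintro ⟨u, hu, rfl⟩
      positivity
    · intro hy
      exact ⟨y / a, by positivity, by field_simp⟩
  have hinj : Set.InjOn (fun u : ℝ => a * u) (Set.Ioi 0) := by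
    intro x _ b _ h
    exact mul_left_cancel₀ ha.ne' h
  have hd : ∀ u ∈ (Set.Ioi 0 : Set ℝ), HasDerivWithinAt (fun u : ℝ => a * u)
      a (Set.Ioi 0) u := by
    intro u _
    simpa using ((hasDerivAt_id u).const_mul a).hasDerivWithinAt (s := Set.Ioi 0)
  conv_lhs => rw [← himg]
  rw [lintegral_image_eq_lintegral_abs_deriv_mul measurableSet_Ioi hd hinj, abs_of_pos ha]

lemma aux_sym (g : ℝ → ENNReal) (hg : Measurable g) :
    ∫⁻ u : ℝ, g u = ∫⁻ u in Set.Ioi (0:ℝ), (g u + g (-u)) := by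
  rw [lintegral_add_left hg]
  have h1 : ∫⁻ u in Set.Ioi (0:ℝ), g (-u) = ∫⁻ u in Set.Iic (0:ℝ), g u := by
    have hinj : Set.InjOn (fun u : ℝ => -u) (Set.Ioi 0) := neg_injective.injOn
    have hd : ∀ u ∈ (Set.Ioi 0 : Set ℝ), HasDerivWithinAt (fun u : ℝ => -u)
        (-1) (Set.Ioi 0) u := fun u _ => (hasDerivAt_neg u).hasDerivWithinAt
    have himg : (fun u : ℝ => -u) '' Set.Ioi 0 = Set.Iio 0 := by simp
    have := lintegral_image_eq_lintegral_abs_deriv_mul measurableSet_Ioi hd hinj g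
    rw [himg] at this
    rw [setLIntegral_congr Iio_ae_eq_Iic.symm, this]
    simp
  rw [h1, add_comm, ← lintegral_add_compl g (measurableSet_Iic (a := (0:ℝ))), Set.compl_Iic]

lemma aux_int1 (z : ℝ) (hz : 0 < z) :
    IntegrableOn (fun u => Real.exp (-z * Real.cosh u) * Real.cosh (1 * u)) (Set.Ioi 0) := by
  have hb : IntegrableOn (fun u : ℝ => 4 / z ^ 2 * Real.exp (-u)) (Set.Ioi 0) :=
    (integrableOn_exp_neg_Ioi 0).const_mul _
  refine Integrable.mono' hb (by fun_prop) (Filter.Eventually.of_forall fun u => ?_)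
  have hw := Real.cosh_pos u
  rw [one_mul, Real.norm_of_nonneg (by positivity)]
  set w := Real.cosh u with hwdef
  have h1 : Real.exp u ≤ 2 * w := by
    rw [hwdef, Real.cosh_eq]
    have := Real.exp_pos (-u)
    linarith
  have h2 : (z * w) ^ 2 / 2 ≤ Real.exp (z * w) := by
    have := Real.quadratic_le_exp_of_nonneg (x := z * w) (by positivity)
    have : 0 < z * w := by positivity
    linarith
  rw [neg_mul, Real.exp_neg, Real.exp_neg]
  have hE := Real.exp_pos (z * w)
  have hu := Real.exp_pos u
  have h3 : (Real.exp (z * w))⁻¹ * w = w / Real.exp (z * w) := by field_simp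
  have h4 : 4 / z ^ 2 * (Real.exp u)⁻¹ = 4 / (z ^ 2 * Real.exp u) := by field_simp
  rw [h3, h4, div_le_div_iff₀ hE (by positivity)]
  calc w * (z ^ 2 * Real.exp u) ≤ w * (z ^ 2 * (2 * w)) := by gcongr
    _ = 4 * ((z * w) ^ 2 / 2) := by ring
    _ ≤ 4 * Real.exp (z * w) := by gcongr

lemma aux_int0 (z : ℝ) (hz : 0 < z) :
    IntegrableOn (fun u => Real.exp (-z * Real.cosh u) * Real.cosh (0 * u)) (Set.Ioi 0) := by
  refine Integrable.mono' (aux_int1 z hz) (by fun_prop) (Filter.Eventually.of_forall fun u => ?_)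
  have hw := Real.one_le_cosh u
  rw [one_mul, zero_mul, Real.cosh_zero, Real.norm_of_nonneg (by positivity)]
  gcongr

lemma aux_bessel_s10 (z r : ℝ) (hz : 0 < z) (hr : 0 < r) :
    ∫⁻ u : ℝ, ENNReal.ofReal ((1 + r * Real.exp u) * Real.exp (-z * Real.cosh u))
      = ENNReal.ofReal (2 * besselK 0 z + 2 * r * besselK 1 z) := by
  rw [aux_sym _ (by fun_prop)]
  have hi : Integrable (fun u => 2 * (Real.exp (-z * Real.cosh u) * Real.cosh (0 * u))
        + 2 * r * (Real.exp (-z * Real.cosh u) * Real.cosh (1 * u)))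
      (volume.restrict (Set.Ioi 0)) :=
    ((aux_int0 z hz).const_mul 2).add ((aux_int1 z hz).const_mul (2 * r))
  have he : 2 * besselK 0 z + 2 * r * besselK 1 z = ∫ u in Set.Ioi (0:ℝ),
      (2 * (Real.exp (-z * Real.cosh u) * Real.cosh (0 * u))
        + 2 * r * (Real.exp (-z * Real.cosh u) * Real.cosh (1 * u))) := by
    rw [integral_add ((aux_int0 z hz).const_mul 2) ((aux_int1 z hz).const_mul (2 * r)),
      integral_const_mul, integral_const_mul]
    rfl
  rw [he, ofReal_integral_eq_lintegral_ofReal hi]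
  · refine lintegral_congr fun u => ?_
    rw [← ENNReal.ofReal_add (by positivity) (by positivity)]
    congr 1
    simp only [zero_mul, one_mul, Real.cosh_zero, Real.cosh_neg]
    have hc := Real.cosh_eq u
    linear_combination (-2 * r * Real.exp (-z * Real.cosh u)) * hc
  · refine Filter.Eventually.of_forall fun u => ?_
    have h0 := Real.cosh_pos (0 * u)
    have h1 := Real.cosh_pos (1 * u)
    simp only [Pi.zero_apply]
    positivity

lemma aux_weight (s t : ℝ) (hs : 0 < s) (ht : 0 < t) :
    (1 + s) * ((1 + s) * t / s) * (((1 + s) * t) ^ ((1:ℝ)/2) /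
      (((1 + s) * t / s) ^ ((1:ℝ)/2) * ((1 + s) * t + (1 + s) * t / s) ^ ((1:ℝ)/2)))
      = t ^ ((1:ℝ)/2) * (1 + s) := by
  simp only [← Real.sqrt_eq_rpow]
  have h1 : (1 + s) * t + (1 + s) * t / s = (1 + s) ^ 2 * t / s := by field_simp; ring
  rw [h1, Real.sqrt_div (by positivity), Real.sqrt_div (by positivity),
    Real.sqrt_mul (x := (1 + s) ^ 2) (by positivity), Real.sqrt_sq (by positivity),
    Real.sqrt_mul (by positivity)]
  have hs2 := Real.sq_sqrt hs.le
  have ht2 := Real.sq_sqrt ht.le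
  have a1 : 0 < √s := Real.sqrt_pos.2 hs
  have a2 : 0 < √t := Real.sqrt_pos.2 ht
  have a3 : 0 < √(1 + s) := Real.sqrt_pos.2 (by positivity)
  field_simp
  rw [hs2, ht2]
  try field_simp

theorem stmt_10 (p q : ℝ) (hp : 0 < p) (hq : 0 < q) (f : ℝ → ℝ)
    (hf : Measurable f) (hf0 : ∀ t, 0 ≤ f t) :
    (∫⁻ x in Set.Ioi (0:ℝ), ∫⁻ y in Set.Ioi (0:ℝ),
        ENNReal.ofReal ((x ^ ((1:ℝ)/2) / (y ^ ((1:ℝ)/2) * (x + y) ^ ((1:ℝ)/2))) *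
          f (x * y / (x + y)) * Real.exp (-p * x - q * y)))
    = ENNReal.ofReal (2 / Real.sqrt p) *
      ∫⁻ t in Set.Ioi (0:ℝ),
        ENNReal.ofReal (f t * t ^ ((1:ℝ)/2) * Real.exp (-(p + q) * t) *
          (Real.sqrt p * besselK 0 (2 * Real.sqrt p * Real.sqrt q * t) +
           Real.sqrt q * besselK 1 (2 * Real.sqrt p * Real.sqrt q * t))) := by
  have hP : 0 < √p := Real.sqrt_pos.2 hp
  have hQ : 0 < √q := Real.sqrt_pos.2 hq
  have hp2 := Real.sq_sqrt hp.le
  have hq2 := Real.sq_sqrt hq.le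
  set P := √p
  set Q := √q
  set r := Q / P with hr
  have hr0 : 0 < r := by positivity
  let G : ℝ → ℝ → ENNReal := fun x y =>
    ENNReal.ofReal ((x ^ ((1:ℝ)/2) / (y ^ ((1:ℝ)/2) * (x + y) ^ ((1:ℝ)/2))) *
          f (x * y / (x + y)) * Real.exp (-p * x - q * y))
  have hG : Measurable (Function.uncurry G) := by
    unfold G Function.uncurry
    fun_prop
  have step1 : (∫⁻ x in Set.Ioi (0:ℝ), ∫⁻ y in Set.Ioi (0:ℝ), G x y)
      = ∫⁻ x in Set.Ioi (0:ℝ), ∫⁻ u : ℝ,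
        ENNReal.ofReal (x / r * Real.exp (-u)) * G x (x / r * Real.exp (-u)) := by
    refine setLIntegral_congr_fun measurableSet_Ioi fun x hx => ?_
    have hx : 0 < x := hx
    exact aux_sub_exp (x / r) (by positivity) _
  have hG2 : Measurable (fun v : ℝ × ℝ => G v.1 (v.1 / r * Real.exp (-v.2))) :=
    hG.comp (g := Function.uncurry G) (f := fun v : ℝ × ℝ => (v.1, v.1 / r * Real.exp (-v.2)))
      (by fun_prop)
  change (∫⁻ x in Set.Ioi (0:ℝ), ∫⁻ y in Set.Ioi (0:ℝ), G x y) = _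
  rw [step1, lintegral_lintegral_swap]
  swap
  · unfold Function.uncurry
    exact (Measurable.mul (by fun_prop) hG2).aemeasurable
  have step2 : ∀ u : ℝ, (∫⁻ x in Set.Ioi (0:ℝ),
        ENNReal.ofReal (x / r * Real.exp (-u)) * G x (x / r * Real.exp (-u)))
      = ∫⁻ t in Set.Ioi (0:ℝ), ENNReal.ofReal (f t * t ^ ((1:ℝ)/2) * Real.exp (-(p + q) * t)) *
          ENNReal.ofReal ((1 + r * Real.exp u) * Real.exp (-(2 * P * Q * t) * Real.cosh u)) := by
    intro u
    have hs : 0 < r * Real.exp u := by positivity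
    rw [aux_sub_scale (1 + r * Real.exp u) (by positivity)]
    refine setLIntegral_congr_fun measurableSet_Ioi fun t ht => ?_
    have ht : 0 < t := ht
    have hft := hf0 t
    set s := r * Real.exp u with hsd
    have hy : (1 + s) * t / r * Real.exp (-u) = (1 + s) * t / s := by
      rw [hsd, Real.exp_neg]; field_simp
    have harg : (1 + s) * t * ((1 + s) * t / s) / ((1 + s) * t + (1 + s) * t / s) = t := by
      field_simp
      try ring
    have hexp : Real.exp (-p * ((1 + s) * t) - q * ((1 + s) * t / s))
        = Real.exp (-(p + q) * t) * Real.exp (-(2 * P * Q * t) * Real.cosh u) := by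
      rw [← Real.exp_add]
      congr 1
      have e1 : p * s = P * Q * Real.exp u := by
        rw [hsd, hr, ← hp2]; field_simp
      have e2 : q / s = P * Q * Real.exp (-u) := by
        rw [hsd, hr, ← hq2, Real.exp_neg]; field_simp
      have e3 : q * ((1 + s) * t / s) = q / s * t + q * t := by field_simp
      rw [e3, e2, Real.cosh_eq]
      linear_combination (-t) * e1
    have hw := aux_weight s t hs ht
    simp only [G]
    rw [hy, harg, hexp, ← ENNReal.ofReal_mul (by positivity), ← ENNReal.ofReal_mul (by positivity),
      ← ENNReal.ofReal_mul (by positivity)]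
    congr 1
    linear_combination (f t * (Real.exp (-(p + q) * t) *
      Real.exp (-(2 * P * Q * t) * Real.cosh u))) * hw
  simp_rw [step2]
  rw [lintegral_lintegral_swap]
  swap
  · unfold Function.uncurry
    exact Measurable.aemeasurable (by fun_prop)
  rw [← lintegral_const_mul' _ _ ENNReal.ofReal_ne_top]
  refine setLIntegral_congr_fun measurableSet_Ioi fun t ht => ?_
  have ht : 0 < t := ht
  have hft := hf0 t
  rw [lintegral_const_mul' _ _ ENNReal.ofReal_ne_top, aux_bessel_s10 _ _ (by positivity) hr0,
    ← ENNReal.ofReal_mul (by positivity), ← ENNReal.ofReal_mul (by positivity)]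
  congr 1
  rw [hr]
  field_simp
end
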